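/- Let p be a prime, let d ≥ 1 with d dividing p − 1, let n ≥ 1 with d ≥ n + 1, and let S = 𝔽_p[x_0, x_1, …, x_n] and f = x_0^d + x_1^d + ⋯ + x_n^d ∈ S. Let m ≥ 1 be an integer and let z ∈ S be a homogeneous polynomial of degree m(n+1) − d. If f^{p−1} · z^p lies in the ideal (x_0^{mp}, x_1^{mp}, …, x_n^{mp}) of S, then z ∈ (x_0^m, x_1^m, …, x_n^m). -/

import Mathlib

open MvPolynomial

namespace MvPolynomial

variable {σ R : Type*} [CommSemiring R]

/-- A polynomial lies in the ideal generated by the `m`-th powers of the variables iff each of its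
monomials has some exponent at least `m`. -/
theorem mem_span_range_X_pow_iff {m : ℕ} {z : MvPolynomial σ R} :
    z ∈ Ideal.span (Set.range fun i : σ => (X i : MvPolynomial σ R) ^ m) ↔
      ∀ a ∈ z.support, ∃ i, m ≤ a i := by
  have h := @mem_ideal_span_monomial_image σ R _ z (Set.range fun i => Finsupp.single i m)
  rw [← Set.range_comp] at h
  simpa [Function.comp_def, X_pow_eq_monomial] using h

/-- If `N < p` and `p` is coprime to `d`, each coefficient of the product of `(∑ i, X i ^ d) ^ N`
and `expand p φ` comes from a single pair of monomials. -/
theorem coeff_sum_X_pow_pow_mul_expand [Fintype σ] [DecidableEq σ] {p d N : ℕ} (hN : N < p)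
    (hpd : p.Coprime d) (φ : MvPolynomial σ R) (k a : σ →₀ ℕ) (hk : ∑ i, k i = N) :
    coeff (d • k + p • a) ((∑ i, X i ^ d : MvPolynomial σ R) ^ N * expand p φ) =
      Nat.multinomial Finset.univ k * coeff a φ := by
  have hmon (l : σ → ℕ) : ∏ i, ((X i : MvPolynomial σ R) ^ d) ^ l i =
      monomial (d • Finsupp.equivFunOnFinite.symm l) 1 := by
    rw [monomial_eq, Finsupp.prod_fintype _ _ (by simp)]
    simp [pow_mul]
  rw [Finset.sum_pow_eq_sum_piAntidiag, Finset.sum_mul, coeff_sum,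
    Finset.sum_eq_single (k : σ → ℕ)]
  · rw [hmon, mul_assoc, ← map_natCast (C : R →+* MvPolynomial σ R), coeff_C_mul]
    simp only [Finsupp.equivFunOnFinite_symm_coe, coeff_monomial_mul, one_mul]
    rw [coeff_expand_smul p (by lia)]
  · intro l hl hlk
    rw [hmon, mul_assoc, ← map_natCast (C : R →+* MvPolynomial σ R), coeff_C_mul,
      coeff_monomial_mul']
    split_ifs with hle
    · obtain ⟨i, hi⟩ := Function.ne_iff.mp hlk
      rw [coeff_expand_of_not_dvd (i := i), mul_zero, mul_zero]
      intro hdvd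
      have hli : l i < p := by
        have h := Finset.single_le_sum (f := l) (fun _ _ => Nat.zero_le _) (Finset.mem_univ i)
        rw [(Finset.mem_piAntidiag.mp hl).1] at h
        lia
      have hki : k i < p := by
        have h := Finset.single_le_sum (f := k) (fun _ _ => Nat.zero_le _) (Finset.mem_univ i)
        lia
      have hlei := hle i
      simp only [Finsupp.tsub_apply, Finsupp.add_apply, Finsupp.smul_apply, smul_eq_mul,
        Finsupp.equivFunOnFinite_symm_apply_apply] at hdvd hlei
      have hmod : d * l i ≡ d * k i [MOD p] :=
        ((Nat.modEq_iff_dvd' hlei).mpr hdvd).trans (by simp [Nat.ModEq])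
      exact hi ((Nat.ModEq.cancel_left_of_coprime hpd hmod).eq_of_lt_of_lt hli hki)
    · rw [mul_zero]
  · intro h
    exact absurd (by simpa using hk) h

end MvPolynomial

/-- A multinomial coefficient of total degree less than a prime `p` is not divisible by `p`. -/
theorem Nat.Prime.not_dvd_multinomial {α : Type*} {p : ℕ} (hp : p.Prime) (s : Finset α)
    (k : α → ℕ) (hk : ∑ i ∈ s, k i < p) : ¬ p ∣ Nat.multinomial s k := fun h =>
  absurd (hp.dvd_factorial.mp (Nat.multinomial_spec s k ▸ h.mul_left _)) hk.not_ge

/-- ideal-theoretic form of the conclusion of Example 2.10. With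
`f = x_0^d + ⋯ + x_n^d ∈ 𝔽_p[x_0, …, x_n]`, `d ∣ p − 1`, `d ≥ n + 1`, `m ≥ 1`, and `z`
homogeneous of degree `m(n+1) − d`: if `f^{p−1} z^p ∈ (x_0^{mp}, …, x_n^{mp})`, then
`z ∈ (x_0^m, …, x_n^m)`. -/
theorem stmt_12 (p : ℕ) (hp : p.Prime) (d n : ℕ) (hd : 1 ≤ d) (hdvd : d ∣ p - 1)
    (hn : 1 ≤ n) (hdn : n + 1 ≤ d) (m : ℕ) (hm : 1 ≤ m)
    (z : MvPolynomial (Fin (n + 1)) (ZMod p))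
    (D : ℕ) (hD : (D : ℤ) = (m : ℤ) * (n + 1) - d) (hzD : z.IsHomogeneous D)
    (hz : (∑ i, X i ^ d : MvPolynomial (Fin (n + 1)) (ZMod p)) ^ (p - 1) * z ^ p ∈
      Ideal.span (Set.range fun i : Fin (n + 1) =>
        (X i : MvPolynomial (Fin (n + 1)) (ZMod p)) ^ (m * p))) :
    z ∈ Ideal.span (Set.range fun i : Fin (n + 1) =>
        (X i : MvPolynomial (Fin (n + 1)) (ZMod p)) ^ m) := by
  have := Fact.mk hp
  rw [mem_span_range_X_pow_iff] at hz ⊢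
  intro a ha
  by_contra! ham
  obtain ⟨c, hc⟩ := hdvd
  have hdeg : ∑ i, a i = D := by
    rw [← Finsupp.degree_eq_sum]
    exact not_imp_comm.mp hzD.coeff_eq_zero (mem_support_iff.mp ha)
  let k : Fin (n + 1) →₀ ℕ := Finsupp.equivFunOnFinite.symm fun i => c * (m - a i)
  have hk : ∑ i, k i = p - 1 := by
    have hsub : ∑ i, (m - a i) = d := by
      have h : ∑ i, (m - a i) + ∑ i, a i = (n + 1) * m := by
        rw [← Finset.sum_add_distrib, Finset.sum_congr rfl fun i _ => Nat.sub_add_cancel (ham i).le]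
        simp
      rw [hdeg] at h
      zify at h ⊢
      linarith
    simp only [k, Finsupp.equivFunOnFinite_symm_apply_apply]
    rw [← Finset.mul_sum, hsub, hc, mul_comm]
  have hp1 := hp.one_lt
  have hpd : p.Coprime d := by
    refine (Nat.Coprime.coprime_dvd_left ⟨c, hc⟩ ?_).symm
    exact (Nat.coprime_self_sub_left hp1.le).mpr (Nat.coprime_one_left p)
  have hcoeff := coeff_sum_X_pow_pow_mul_expand (N := p - 1) (by lia) hpd z k a hk
  rw [expand_zmod] at hcoeff
  obtain ⟨i, hi⟩ := hz (d • k + p • a) <| by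
    rw [mem_support_iff, hcoeff]
    refine mul_ne_zero ?_ (mem_support_iff.mp ha)
    rw [Ne, ZMod.natCast_eq_zero_iff]
    exact hp.not_dvd_multinomial _ _ (by lia)
  simp only [k, Finsupp.add_apply, Finsupp.smul_apply, smul_eq_mul,
    Finsupp.equivFunOnFinite_symm_apply_apply, ← mul_assoc, ← hc] at hi
  obtain ⟨t, ht⟩ := Nat.exists_eq_add_of_lt (ham i)
  obtain ⟨q, rfl⟩ := Nat.exists_eq_add_of_lt hp1
  have hmt : m - a i = t + 1 := by lia
  rw [hmt, ht] at hi
  simp only [Nat.add_sub_cancel] at hi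
  nlinarith
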